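/- Let U be a nonempty finite set, D ≥ 0, P ≥ 0, and let p be a probability mass function on {0,1} × U × {0,1} for a triple (X, U, X̂) such that: (i) the marginal of X is uniform on {0,1}; (ii) the Markov chain condition holds: p(x,u,x̂)·p_U(u) = p_{XU}(x,u)·p_{UX̂}(u,x̂) for all (x,u,x̂); (iii) ∑_{x,u,x̂ : x ≠ x̂} p(x,u,x̂) ≤ D; and (iv) ∑_{u : p_U(u)>0} p_U(u)·|p_{X|U}(1|u) − p_{X̂|U}(1|u)| ≤ P. Then ∑_{u : p_U(u)>0} p_U(u)·H_b(p_{X|U}(1|u)) ≤ ħ̄(D,P); equivalently, the mutual information I(X;U) = log 2 − ∑_{u} p_U(u)·H_b(p_{X|U}(1|u)) satisfies I(X;U) ≥ log 2 − ħ̄(D,P). -/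

import Mathlib

/-- The binary entropy function (natural logarithm, `Real.log 0 = 0`). -/
noncomputable def Hb (a : ℝ) : ℝ :=
  -(a * Real.log a) - (1 - a) * Real.log (1 - a)

/-- The function `ħ(D,P)` from the paper. -/
noncomputable def hbar (D P : ℝ) : ℝ :=
  if D < 1 / 2 then
    Hb ((1 + min D P - Real.sqrt (1 + (min D P) ^ 2 - 2 * D)) / 2)
  else Real.log 2

open Finset

/-- The upper concave envelope of `ħ` over `[0,∞)²`. -/
noncomputable def hbarEnv (D P : ℝ) : ℝ :=
  sSup { v | ∃ (k : ℕ) (α : Fin k → ℝ) (DP : Fin k → ℝ × ℝ),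
    (∀ i, 0 ≤ α i) ∧ (∑ i, α i) = 1 ∧
    (∀ i, 0 ≤ (DP i).1 ∧ 0 ≤ (DP i).2) ∧
    (∑ i, α i • DP i) = (D, P) ∧
    v = ∑ i, α i * hbar (DP i).1 (DP i).2 }

/-- `p` is a probability mass function on the finite type `α`. -/
def IsPMF {α : Type*} [Fintype α] (p : α → ℝ) : Prop :=
  (∀ a, 0 ≤ p a) ∧ ∑ a, p a = 1

/-- The `U`-marginal of a pmf on `{0,1} × U × {0,1}`. -/
noncomputable def margU {U : Type*} [Fintype U] (p : Bool × U × Bool → ℝ) (u : U) : ℝ :=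
  ∑ x, ∑ y, p (x, u, y)

/-- The `(X,U)`-marginal of a pmf on `{0,1} × U × {0,1}`. -/
noncomputable def margXU {U : Type*} [Fintype U] (p : Bool × U × Bool → ℝ)
    (x : Bool) (u : U) : ℝ :=
  ∑ y, p (x, u, y)

/-- The `(U,X̂)`-marginal of a pmf on `{0,1} × U × {0,1}`. -/
noncomputable def margUXhat {U : Type*} [Fintype U] (p : Bool × U × Bool → ℝ)
    (u : U) (y : Bool) : ℝ :=
  ∑ x, p (x, u, y)

theorem Hb_eq_binEntropy (a : ℝ) : Hb a = Real.binEntropy a := by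
  simp only [Hb, Real.binEntropy, Real.log_inv]
  ring

theorem Hb_le_log_two (a : ℝ) : Hb a ≤ Real.log 2 :=
  Hb_eq_binEntropy a ▸ Real.binEntropy_le_log_two

theorem Hb_one_sub (a : ℝ) : Hb (1 - a) = Hb a := by
  simp only [Hb, sub_sub_cancel]
  ring

theorem Hb_le_Hb {a b : ℝ} (ha : 0 ≤ a) (hab : a ≤ b) (hb : b ≤ 1 / 2) : Hb a ≤ Hb b := by
  rw [Hb_eq_binEntropy, Hb_eq_binEntropy]
  refine Real.binEntropy_strictMonoOn.monotoneOn ⟨ha, ?_⟩ ⟨ha.trans hab, ?_⟩ hab <;> linarith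

theorem hbar_le_log_two (D P : ℝ) : hbar D P ≤ Real.log 2 := by
  unfold hbar
  split_ifs
  · exact Hb_le_log_two _
  · exact le_rfl

theorem hbar_mono {D P D' P' : ℝ} (hD : 0 ≤ D) (hP : 0 ≤ P) (hDD : D ≤ D') (hPP : P ≤ P') :
    hbar D P ≤ hbar D' P' := by
  by_cases hD' : D' < 1 / 2
  · rw [hbar, hbar, if_pos hD', if_pos (hDD.trans_lt hD')]
    have hm0 : 0 ≤ min D P := le_min hD hP
    have hmm : min D P ≤ min D' P' := min_le_min hDD hPP
    set m := min D P
    set m' := min D' P'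
    have hs := Real.sq_sqrt (show 0 ≤ 1 + m ^ 2 - 2 * D by nlinarith)
    have hs' := Real.sq_sqrt (show 0 ≤ 1 + m' ^ 2 - 2 * D' by nlinarith)
    have hs0 := Real.sqrt_nonneg (1 + m ^ 2 - 2 * D)
    have hs0' := Real.sqrt_nonneg (1 + m' ^ 2 - 2 * D')
    set s := √(1 + m ^ 2 - 2 * D)
    set s' := √(1 + m' ^ 2 - 2 * D')
    have hms : m < s := by nlinarith
    have hms' : m' < s' := by nlinarith
    have hle : s ≤ 1 + m := by nlinarith
    refine Hb_le_Hb (by linarith) ?_ (by linarith)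
    by_contra! hlt
    nlinarith [mul_pos (show 0 < s - m by linarith) (show 0 < s' - s by linarith)]
  · have h : hbar D' P' = Real.log 2 := if_neg hD'
    exact h ▸ hbar_le_log_two D P

theorem Hb_le_hbar {a b : ℝ} (ha0 : 0 ≤ a) (ha1 : a ≤ 1) (hb0 : 0 ≤ b) (hb1 : b ≤ 1) :
    Hb a ≤ hbar (a * (1 - b) + b * (1 - a)) |a - b| := by
  unfold hbar
  split_ifs with h
  · have hle : |a - b| ≤ a * (1 - b) + b * (1 - a) := by
      rw [abs_le]
      constructor <;> nlinarith
    have hsq : 1 + |a - b| ^ 2 - 2 * (a * (1 - b) + b * (1 - a)) = (1 - a - b) ^ 2 := by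
      rw [sq_abs]
      ring
    rw [min_eq_right hle, hsq, Real.sqrt_sq_eq_abs]
    rcases le_or_gt a (1 / 2) with ha | ha
    · have hb : b < 1 / 2 := by nlinarith
      rw [abs_of_nonneg (show 0 ≤ 1 - a - b by linarith)]
      have := le_abs_self (a - b)
      have : |a - b| ≤ 1 - a - b := abs_le.2 ⟨by linarith, by linarith⟩
      exact Hb_le_Hb ha0 (by linarith) (by linarith)
    · have hb : 1 / 2 < b := by nlinarith
      rw [abs_of_nonpos (show 1 - a - b ≤ 0 by linarith), ← Hb_one_sub a]
      have := neg_abs_le (a - b)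
      have : |a - b| ≤ -(1 - a - b) := abs_le.2 ⟨by linarith, by linarith⟩
      exact Hb_le_Hb (by linarith) (by linarith) (by linarith)
  · exact Hb_le_log_two a

theorem sum_mul_hbar_le_hbarEnv {ι : Type*} [Fintype ι] {w d q : ι → ℝ} {D P : ℝ}
    (hw : ∀ i, 0 ≤ w i) (hw1 : ∑ i, w i = 1) (hd : ∀ i, 0 ≤ d i) (hq : ∀ i, 0 ≤ q i)
    (hD : ∑ i, w i * d i ≤ D) (hP : ∑ i, w i * q i ≤ P) :
    ∑ i, w i * hbar (d i) (q i) ≤ hbarEnv D P := by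
  set δ := D - ∑ i, w i * d i with hδ
  set ε := P - ∑ i, w i * q i with hε
  have hδ0 : 0 ≤ δ := sub_nonneg.2 hD
  have hε0 : 0 ≤ ε := sub_nonneg.2 hP
  calc ∑ i, w i * hbar (d i) (q i)
      ≤ ∑ i, w i * hbar (d i + δ) (q i + ε) := by
        gcongr with i
        · exact hw i
        · exact hbar_mono (hd i) (hq i) (by linarith) (by linarith)
    _ ≤ hbarEnv D P := by
        refine le_csSup ⟨Real.log 2, ?_⟩ ?_
        · rintro v ⟨k, α, DP, hα, hα1, -, -, rfl⟩
          calc ∑ i, α i * hbar (DP i).1 (DP i).2 ≤ ∑ i, α i * Real.log 2 := by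
                gcongr with i
                · exact hα i
                · exact hbar_le_log_two _ _
            _ = Real.log 2 := by rw [← Finset.sum_mul, hα1, one_mul]
        · let e := (Fintype.equivFin ι).symm
          refine ⟨Fintype.card ι, fun j => w (e j), fun j => (d (e j) + δ, q (e j) + ε),
            fun j => hw _, ?_, fun j => ⟨add_nonneg (hd _) hδ0, add_nonneg (hq _) hε0⟩, ?_, ?_⟩
          · rw [e.sum_comp w, hw1]
          · rw [e.sum_comp fun i => w i • (d i + δ, q i + ε)]
            ext
            · simp [Prod.fst_sum, mul_add, Finset.sum_add_distrib, ← Finset.sum_mul, hw1, hδ]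
            · simp [Prod.snd_sum, mul_add, Finset.sum_add_distrib, ← Finset.sum_mul, hw1, hε]
          · exact (e.sum_comp fun i => w i * hbar (d i + δ) (q i + ε)).symm

/-- Converse bound for the uniform Bernoulli source: any Markov triple `(X,U,X̂)` with
uniform `X`, distortion at most `D` and conditional perception at most `P` satisfies
`∑_u p_U(u)·H_b(p_{X|U}(1|u)) ≤ ħ̄(D,P)`, i.e. `I(X;U) ≥ log 2 − ħ̄(D,P)`. -/
theorem binary_converse {U : Type*} [Fintype U] [Nonempty U]
    (D P : ℝ) (hD : 0 ≤ D) (hP : 0 ≤ P)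
    (p : Bool × U × Bool → ℝ) (hpmf : IsPMF p)
    (hXunif : ∀ x : Bool, (∑ u, ∑ y, p (x, u, y)) = 1 / 2)
    (hMarkov : ∀ x u y, p (x, u, y) * margU p u = margXU p x u * margUXhat p u y)
    (hdist : (∑ x, ∑ u, ∑ y, if x ≠ y then p (x, u, y) else 0) ≤ D)
    (hperc : (∑ u, if 0 < margU p u then
        margU p u * |margXU p true u / margU p u - margUXhat p u true / margU p u|
      else 0) ≤ P) :
    (∑ u, if 0 < margU p u then margU p u * Hb (margXU p true u / margU p u) else 0)
      ≤ hbarEnv D P := by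
  have hp := hpmf.1
  have hU : ∀ u, margU p u = p (true, u, true) + p (true, u, false)
      + (p (false, u, true) + p (false, u, false)) := fun u => by simp [margU]
  have hX : ∀ u, margXU p true u = p (true, u, true) + p (true, u, false) :=
    fun u => by simp [margXU]
  have hY : ∀ u, margUXhat p u true = p (true, u, true) + p (false, u, true) :=
    fun u => by simp [margUXhat]
  have hw : ∀ u, 0 ≤ margU p u := fun u => by
    rw [hU]
    linarith [hp (true, u, true), hp (true, u, false), hp (false, u, true), hp (false, u, false)]
  have hw1 : ∑ u, margU p u = 1 := by
    have ht := hXunif true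
    have hf := hXunif false
    simp only [margU, Fintype.sum_bool, Finset.sum_add_distrib] at ht hf ⊢
    linarith
  set a := fun u => margXU p true u / margU p u with ha
  set b := fun u => margUXhat p u true / margU p u with hb
  have ha0 : ∀ u, 0 ≤ a u := fun u =>
    div_nonneg (by rw [hX]; exact add_nonneg (hp _) (hp _)) (hw u)
  have hb0 : ∀ u, 0 ≤ b u := fun u =>
    div_nonneg (by rw [hY]; exact add_nonneg (hp _) (hp _)) (hw u)
  have ha1 : ∀ u, a u ≤ 1 := fun u => div_le_one_of_le₀
    (by rw [hX, hU]; linarith [hp (false, u, true), hp (false, u, false)]) (hw u)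
  have hb1 : ∀ u, b u ≤ 1 := fun u => div_le_one_of_le₀
    (by rw [hY, hU]; linarith [hp (true, u, false), hp (false, u, false)]) (hw u)
  have hd : ∀ u, margU p u * (a u * (1 - b u) + b u * (1 - a u))
      = p (true, u, false) + p (false, u, true) := fun u => by
    rcases (hw u).eq_or_lt with h0 | h0
    · have := hU u
      rw [← h0, zero_mul]
      linarith [hp (true, u, true), hp (true, u, false), hp (false, u, true), hp (false, u, false)]
    · have h1 := hMarkov true u false
      have h2 := hMarkov false u true
      have h3 : margUXhat p u false = margU p u - margUXhat p u true := by
        simp [margUXhat, margU]; ring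
      have h4 : margXU p false u = margU p u - margXU p true u := by
        simp [margXU, margU]
      rw [h3] at h1
      rw [h4] at h2
      simp only [ha, hb]
      field_simp
      linarith
  have hite : ∀ f : U → ℝ, (∑ u, if 0 < margU p u then margU p u * f u else 0)
      = ∑ u, margU p u * f u := fun f => Finset.sum_congr rfl fun u _ => by
    split_ifs with h
    · rfl
    · rw [le_antisymm (not_lt.1 h) (hw u), zero_mul]
  rw [hite fun u => |a u - b u|] at hperc
  rw [hite fun u => Hb (a u)]
  have hdist' : ∑ u, margU p u * (a u * (1 - b u) + b u * (1 - a u)) ≤ D := by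
    simp only [hd, Finset.sum_add_distrib]
    simpa using hdist
  calc ∑ u, margU p u * Hb (a u)
      ≤ ∑ u, margU p u * hbar (a u * (1 - b u) + b u * (1 - a u)) |a u - b u| := by
        gcongr with u
        · exact hw u
        · exact Hb_le_hbar (ha0 u) (ha1 u) (hb0 u) (hb1 u)
    _ ≤ hbarEnv D P := sum_mul_hbar_le_hbarEnv hw hw1
        (fun u => add_nonneg (mul_nonneg (ha0 u) (sub_nonneg.2 (hb1 u)))
          (mul_nonneg (hb0 u) (sub_nonneg.2 (ha1 u))))
        (fun u => abs_nonneg _) hdist' hperc
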